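/- arXiv:2602.22512 — 2 statements merged into one kernel-verified Lean document; each statement's English description precedes it below -/
import Mathlib

section
/- Let $a,b\in\mathbb{N}$ with $1\le a\le b$, $c,d\in\mathbb{R}$, $s\in(0,1)$, $\delta\in(0,1/2]$, and $\rho>1$. Then $\mathcal{H}^s_\rho(\{x\in[0,1]:\|ax+c\|\cdot\|bx+d\|<\delta^2\})\le C_s\,(b(\delta^2/b)^s+\gcd(a,b)(\delta^2/(ab))^{s/2})$, where $C_s$ depends only on $s$. -/
open Set
open scoped ENNReal

/-- Distance from `x` to the nearest integer. -/
noncomputable def nint (x : ℝ) : ℝ := |x - round x|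

/-- Hausdorff `s`-pre-measure at scale `ρ`: infimum of `∑ rᵢ^s` over countable covers
of `F` by balls of radius `rᵢ < ρ`. -/
noncomputable def preH (s ρ : ℝ) (F : Set ℝ) : ℝ≥0∞ :=
  ⨅ (c : ℕ → ℝ) (r : ℕ → ℝ) (_ : ∀ n, 0 < r n ∧ r n < ρ)
    (_ : F ⊆ ⋃ n, Metric.ball (c n) (r n)), ∑' n, ENNReal.ofReal (r n ^ s)

/-- A finite cover bounds the pre-measure. -/
theorem preH_le_sum {ι : Type*} {s ρ : ℝ} (hs : 0 < s) (hρ : 0 < ρ) {F : Set ℝ} (T : Finset ι)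
    (c r : ι → ℝ) (hr : ∀ i ∈ T, 0 < r i ∧ r i < ρ)
    (hF : ∀ x ∈ F, ∃ i ∈ T, |x - c i| < r i) :
    preH s ρ F ≤ ENNReal.ofReal (∑ i ∈ T, r i ^ s) := by
  rw [ENNReal.ofReal_sum_of_nonneg fun i hi => Real.rpow_nonneg (hr i hi).1.le _]
  refine ENNReal.le_of_forall_pos_le_add fun ε hε _ => ?_
  obtain ⟨ε', hpos, hsum⟩ := ENNReal.exists_pos_sum_of_countable
    (ENNReal.coe_ne_zero.2 hε.ne') ℕ
  have : Countable T := Finset.countable_toSet T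
  obtain ⟨e⟩ : Nonempty ((T ⊕ ℕ) ≃ ℕ) := nonempty_equiv_of_countable
  let c' : T ⊕ ℕ → ℝ := Sum.elim (fun i => c i) (fun _ => 0)
  let r' : T ⊕ ℕ → ℝ := Sum.elim (fun i => r i)
    (fun n => min (ρ / 2) ((ε' n : ℝ) ^ s⁻¹))
  have hr' : ∀ k, 0 < r' k ∧ r' k < ρ := by
    rintro (i | n)
    · exact hr i i.2
    · have : (0 : ℝ) < ε' n := hpos n
      exact ⟨lt_min (by linarith) (Real.rpow_pos_of_pos this _),
        (min_le_left _ _).trans_lt (by linarith)⟩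
  have hcover : F ⊆ ⋃ n, Metric.ball (c' (e.symm n)) (r' (e.symm n)) := by
    intro x hx
    obtain ⟨i, hi, hxi⟩ := hF x hx
    refine mem_iUnion.2 ⟨e (Sum.inl ⟨i, hi⟩), ?_⟩
    simpa [c', r', Real.dist_eq] using hxi
  calc preH s ρ F ≤ ∑' n, ENNReal.ofReal (r' (e.symm n) ^ s) :=
        iInf₂_le_of_le (fun n => c' (e.symm n)) (fun n => r' (e.symm n))
          (iInf₂_le_of_le (fun n => hr' _) hcover le_rfl)
    _ = ∑' k, ENNReal.ofReal (r' k ^ s) :=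
        e.symm.tsum_eq (fun k => ENNReal.ofReal (r' k ^ s))
    _ = ∑' i : T, ENNReal.ofReal (r i ^ s) +
          ∑' n, ENNReal.ofReal (min (ρ / 2) ((ε' n : ℝ) ^ s⁻¹) ^ s) :=
        Summable.tsum_sum ENNReal.summable ENNReal.summable
    _ ≤ _ := by
        rw [Finset.tsum_subtype T (fun i => ENNReal.ofReal (r i ^ s))]
        refine add_le_add le_rfl (le_trans (ENNReal.tsum_le_tsum fun n => ?_) hsum.le)
        have h0 : (0 : ℝ) < ε' n := hpos n
        refine ENNReal.ofReal_le_of_le_toReal ?_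
        calc min (ρ / 2) ((ε' n : ℝ) ^ s⁻¹) ^ s ≤ ((ε' n : ℝ) ^ s⁻¹) ^ s :=
              Real.rpow_le_rpow (hr' (Sum.inr n)).1.le (min_le_right _ _) hs.le
          _ = ((ε' n : ℝ≥0∞)).toReal := by
              rw [Real.rpow_inv_rpow h0.le hs.ne', ENNReal.coe_toReal]

theorem sum_range_rpow_neg_le {s : ℝ} (hs0 : 0 < s) (hs1 : s < 1) (N : ℕ) :
    ∑ i ∈ Finset.range N, ((i + 1 : ℕ) : ℝ) ^ (-s) ≤ (N : ℝ) ^ (1 - s) / (1 - s) := by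
  have h1s : 0 < 1 - s := by linarith
  induction N with
  | zero => simp [Real.zero_rpow h1s.ne']
  | succ N ih =>
    rw [Finset.sum_range_succ]
    have hM : (0 : ℝ) < ((N + 1 : ℕ) : ℝ) := by positivity
    set M : ℝ := ((N + 1 : ℕ) : ℝ) with hMdef
    have hNM : (N : ℝ) = M * (1 + -(1 / M)) := by
      field_simp
      rw [hMdef]
      push_cast
      ring
    have hM1 : 1 / M ≤ 1 := by
      rw [div_le_one hM, hMdef]
      exact_mod_cast Nat.succ_pos N
    have hN : (N : ℝ) ^ (1 - s) ≤ M ^ (1 - s) * (1 + (1 - s) * -(1 / M)) := by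
      rw [hNM, Real.mul_rpow hM.le (by linarith)]
      exact mul_le_mul_of_nonneg_left
        (rpow_one_add_le_one_add_mul_self (by linarith) h1s.le (by linarith)) (by positivity)
    have hMs : M ^ (1 - s) * (1 / M) = M ^ (-s) := by
      rw [show 1 - s = -s + 1 by ring, Real.rpow_add_one hM.ne']
      field_simp
    refine (add_le_add_left ih _).trans ?_
    rw [← le_sub_iff_add_le, ← sub_nonneg]
    have : M ^ (1 - s) / (1 - s) - M ^ (-s) - (N : ℝ) ^ (1 - s) / (1 - s)
        = (M ^ (1 - s) * (1 + (1 - s) * -(1 / M)) - (N : ℝ) ^ (1 - s)) / (1 - s) := by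
      rw [← hMs]
      field_simp
      ring
    rw [this]
    exact div_nonneg (by linarith) h1s.le

theorem sum_Icc_rpow_le {s A B : ℝ} (hs0 : 0 < s) (hs1 : s < 1) (hB : 0 ≤ B) (N : ℕ) :
    ∑ i ∈ Finset.Icc (-N : ℤ) N, (if i = 0 then A else B / |(i : ℝ)|) ^ s
      ≤ A ^ s + 2 * (B ^ s * ((N : ℝ) ^ (1 - s) / (1 - s))) := by
  have hev : Function.Even fun i : ℤ => (if i = 0 then A else B / |(i : ℝ)|) ^ s := by
    intro i
    simp
  rw [Finset.sum_Icc_of_even_eq_range hev, Finset.sum_range_succ']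
  have : ∑ i ∈ Finset.range N,
      (if ((i + 1 : ℕ) : ℤ) = 0 then A else B / |(((i + 1 : ℕ) : ℤ) : ℝ)|) ^ s
      = B ^ s * ∑ i ∈ Finset.range N, ((i + 1 : ℕ) : ℝ) ^ (-s) := by
    rw [Finset.mul_sum]
    refine Finset.sum_congr rfl fun i _ => ?_
    have hi : (0 : ℝ) ≤ ((i + 1 : ℕ) : ℝ) := by positivity
    rw [if_neg (by positivity), Int.cast_natCast, abs_of_nonneg hi, Real.div_rpow hB hi,
      Real.rpow_neg hi, div_eq_mul_inv]
  rw [this]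
  have := mul_le_mul_of_nonneg_left (sum_range_rpow_neg_le hs0 hs1 N) (Real.rpow_nonneg hB s)
  simp only [Nat.cast_zero, if_true, nsmul_eq_mul, Nat.cast_ofNat]
  linarith

/-- If `|p| |q|` is small while `α q - β p` is not, then one of `p`, `q` is very small. -/
theorem small_or_small {α β g δ p q η R t : ℝ} (hα : 0 < α) (hβ : 0 < β) (hg : 0 < g)
    (hη : 0 ≤ η) (hηδ : η = δ ^ 2 / (α * g * (β * g))) (hpq : |p| * |q| < δ ^ 2)
    (ht : t / 2 ≤ |α * q - β * p|)
    (hR : R = √η ∨ (0 < t ∧ R = 4 * δ ^ 2 / g / t)) :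
    |p| < α * g * R ∨ |q| < β * g * R := by
  by_contra! h
  obtain ⟨hp, hq⟩ := h
  have hR0 : 0 ≤ R := by
    rcases hR with rfl | ⟨ht0, rfl⟩ <;> positivity
  rcases hR with rfl | ⟨ht0, hR⟩
  · have h1 : α * g * √η * (β * g * √η) ≤ |p| * |q| :=
      mul_le_mul hp hq (by positivity) (abs_nonneg p)
    have h2 : α * g * √η * (β * g * √η) = δ ^ 2 := by
      rw [show α * g * √η * (β * g * √η) = α * g * (β * g) * (√η * √η) by ring,
        Real.mul_self_sqrt hη, hηδ]
      field_simp
    linarith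
  · have hgR : g * R * t = 4 * δ ^ 2 := by
      rw [hR]
      field_simp
    have htri : t / 2 ≤ α * |q| + β * |p| := by
      refine ht.trans ((abs_sub _ _).trans ?_)
      rw [abs_mul, abs_mul, abs_of_pos hα, abs_of_pos hβ]
    have hcase : t / 4 ≤ α * |q| ∨ t / 4 ≤ β * |p| := by
      by_contra! h
      linarith [h.1, h.2]
    rcases hcase with h | h
    · have h1 : g * R * (t / 4) ≤ g * R * (α * |q|) := by gcongr
      have h2 : α * g * R * |q| ≤ |p| * |q| := by gcongr
      nlinarith
    · have h1 : g * R * (t / 4) ≤ g * R * (β * |p|) := by gcongr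
      have h2 : |p| * (β * g * R) ≤ |p| * |q| := by gcongr
      nlinarith

/-- Solutions `m` of `m * β - n * α = j` are determined by `j` and `m / α`. -/
theorem eq_emod_add_mul_ediv {α β u v m n : ℤ} (huv : u * α + v * β = 1) :
    m = (v * (m * β - n * α)) % α + α * (m / α) := by
  have h : v * (m * β - n * α) = m + α * (-(u * m) - v * n) := by
    linear_combination m * huv
  rw [h, Int.add_mul_emod_self_left, Int.emod_add_mul_ediv]

theorem card_Icc_floor_le {lo hi K : ℝ} (h : hi ≤ lo + K) (hK : -2 ≤ K) :
    ((Finset.Icc ⌊lo⌋ ⌊hi⌋).card : ℝ) ≤ K + 2 := by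
  rw [Int.card_Icc]
  have h1 := Int.floor_le hi
  have h2 := Int.lt_floor_add_one lo
  rcases le_total 0 (⌊hi⌋ + 1 - ⌊lo⌋) with h0 | h0
  · have : (((⌊hi⌋ + 1 - ⌊lo⌋).toNat : ℤ) : ℝ) = ((⌊hi⌋ + 1 - ⌊lo⌋ : ℤ) : ℝ) := by
      rw [Int.toNat_of_nonneg h0]
    rw [Int.cast_natCast] at this
    rw [this]
    push_cast
    linarith
  · rw [Int.toNat_of_nonpos h0]
    simp only [Nat.cast_zero]
    linarith

/-- The pre-measure bound for `a = α * g`, `b = β * g` with `α`, `β` coprime. -/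
theorem preH_nint_mul_nint_le {s : ℝ} (hs0 : 0 < s) (hs1 : s < 1) {α β g : ℕ}
    (hαβ : Nat.Coprime α β) (hα : 0 < α) (hαβle : α ≤ β) (hg : 0 < g) {c d δ ρ : ℝ}
    (hδ : 0 < δ) (hδ2 : δ ≤ 1 / 2) (hρ : 1 < ρ) :
    preH s ρ {x ∈ Icc (0:ℝ) 1 |
        nint ((α * g : ℝ) * x + c) * nint ((β * g : ℝ) * x + d) < δ ^ 2}
      ≤ ENNReal.ofReal (4 * g * (2 * (√(δ ^ 2 / (α * g * (β * g))) ^ s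
          + 2 * ((4 * δ ^ 2 / g) ^ s * ((β : ℝ) ^ (1 - s) / (1 - s)))))) := by
  obtain ⟨u, v, huv⟩ := Nat.isCoprime_iff_coprime.2 hαβ
  have hβ : 0 < β := hα.trans_le hαβle
  have hα' : (1 : ℝ) ≤ α := by exact_mod_cast hα
  have hβ' : (1 : ℝ) ≤ β := by exact_mod_cast hβ
  have hg' : (1 : ℝ) ≤ g := by exact_mod_cast hg
  have hle' : (α : ℝ) ≤ β := by exact_mod_cast hαβle
  have hα0 : (0 : ℝ) < α := by linarith
  have hβ0 : (0 : ℝ) < β := by linarith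
  have hg0 : (0 : ℝ) < g := by linarith
  have hδsq : 4 * δ ^ 2 ≤ 1 := by nlinarith
  set η : ℝ := δ ^ 2 / (α * g * (β * g)) with hη
  have hη0 : 0 < η := by positivity
  set τ : ℝ := β * c - α * d with hτ
  let rad : ℤ → ℝ := fun i => if i = 0 then √η else (4 * δ ^ 2 / g) / |(i : ℝ)|
  let ctr : ℤ → ℤ → Bool → ℝ := fun k i e =>
    let m : ℤ := (v * (i + round τ)) % α + α * k
    bif e then (m - c) / (α * g) else ((m * β - (i + round τ)) / α - d) / (β * g)
  let Q : Finset ℤ := Finset.Icc ⌊(c - 1 / 2) / α⌋ ⌊(α * g + c + 1 / 2) / α⌋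
  let T : Finset (ℤ × ℤ × Bool) := Q ×ˢ (Finset.Icc (-β : ℤ) β ×ˢ Finset.univ)
  have hrad : ∀ i, 0 < rad i ∧ rad i < ρ := by
    intro i
    by_cases hi : i = 0
    · simp only [rad, hi, if_true]
      refine ⟨Real.sqrt_pos.2 hη0, lt_of_le_of_lt ?_ hρ⟩
      refine Real.sqrt_le_iff.2 ⟨zero_le_one, ?_⟩
      rw [hη, one_pow, div_le_one (by positivity)]
      have h1 : (1 : ℝ) ≤ α * g := one_le_mul_of_one_le_of_one_le hα' hg'
      have h2 : (1 : ℝ) ≤ β * g := one_le_mul_of_one_le_of_one_le hβ' hg'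
      have h3 := one_le_mul_of_one_le_of_one_le h1 h2
      nlinarith
    · simp only [rad, hi, if_false]
      have hi1 : (1 : ℝ) ≤ |(i : ℝ)| := by exact_mod_cast Int.one_le_abs hi
      refine ⟨by positivity, lt_of_le_of_lt ?_ hρ⟩
      rw [div_div, div_le_one (by positivity)]
      exact hδsq.trans (one_le_mul_of_one_le_of_one_le hg' hi1)
  refine (preH_le_sum hs0 (by linarith) T (fun t => ctr t.1 t.2.1 t.2.2) (fun t => rad t.2.1)
    (fun t _ => hrad _) ?_).trans (ENNReal.ofReal_le_ofReal ?_)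
  · rintro x ⟨⟨hx0, hx1⟩, hx⟩
    unfold nint at hx
    set m : ℤ := round ((α * g : ℝ) * x + c) with hm
    set n : ℤ := round ((β * g : ℝ) * x + d) with hn
    set p : ℝ := (α * g : ℝ) * x + c - m with hp
    set q : ℝ := (β * g : ℝ) * x + d - n with hq
    have hp2 : |p| ≤ 1 / 2 := abs_sub_round _
    have hq2 : |q| ≤ 1 / 2 := abs_sub_round _
    have hτ2 : |τ - round τ| ≤ 1 / 2 := abs_sub_round _
    set i : ℤ := m * β - n * α - round τ with hi
    have hiτ : (i : ℝ) = (α * q - β * p) + (τ - round τ) := by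
      rw [hi, hp, hq, hτ]
      push_cast
      ring
    have hbound : |(α : ℝ) * q - β * p| ≤ β := by
      refine (abs_sub _ _).trans ?_
      rw [abs_mul, abs_mul, abs_of_pos hα0, abs_of_pos hβ0]
      nlinarith
    have hiN : |i| ≤ (β : ℤ) := by
      have h1 : |(i : ℝ)| ≤ β + 1 / 2 := by
        rw [hiτ]
        exact (abs_add_le _ _).trans (add_le_add hbound hτ2)
      have h2 : ((|i| : ℤ) : ℝ) < ((β + 1 : ℤ) : ℝ) := by
        push_cast
        linarith
      exact Int.lt_add_one_iff.1 (by exact_mod_cast h2)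
    have hi_half : |(i : ℝ)| / 2 ≤ |(α : ℝ) * q - β * p| := by
      by_cases h0 : i = 0
      · simp [h0]
      · have hi1 : (1 : ℝ) ≤ |(i : ℝ)| := by exact_mod_cast Int.one_le_abs h0
        have : |(i : ℝ)| ≤ |(α : ℝ) * q - β * p| + |τ - round τ| := by
          rw [hiτ]
          exact abs_add_le _ _
        linarith
    have hk : m / (α : ℤ) ∈ Q := by
      have hαz : (0 : ℤ) < α := by exact_mod_cast hα
      have hlow : (c - 1 / 2 : ℝ) ≤ m := by
        have : 0 ≤ (α * g : ℝ) * x := by positivity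
        linarith [(abs_le.1 hp2).2]
      have hhigh : (m : ℝ) ≤ α * g + c + 1 / 2 := by
        have : (α * g : ℝ) * x ≤ α * g := mul_le_of_le_one_right (by positivity) hx1
        linarith [(abs_le.1 hp2).1]
      have hd1 : ((α : ℤ) * (m / α) : ℤ) ≤ m := Int.mul_ediv_self_le hαz.ne'
      have hd2 : m < (α : ℤ) * (m / α) + α := Int.lt_mul_ediv_self_add hαz
      have hd1' : (α : ℝ) * ((m / (α : ℤ) : ℤ) : ℝ) ≤ m := by exact_mod_cast hd1
      have hd2' : (m : ℝ) < (α : ℝ) * ((m / (α : ℤ) : ℤ) : ℝ) + α := by exact_mod_cast hd2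
      refine Finset.mem_Icc.2 ⟨Int.lt_add_one_iff.1 (Int.floor_lt.2 ?_), Int.le_floor.2 ?_⟩
      · rw [div_lt_iff₀ hα0]
        push_cast
        linarith
      · rw [le_div_iff₀ hα0]
        linarith
    have hiv : i + round τ = m * β - n * α := by rw [hi]; ring
    have hmeq : (v * (i + round τ)) % α + α * (m / α) = m := by
      rw [hiv]
      exact (eq_emod_add_mul_ediv huv).symm
    have hiv' : (i : ℝ) + round τ = m * β - n * α := by exact_mod_cast hiv
    have hT : ∀ e : Bool, ((m / (α : ℤ), i, e) : ℤ × ℤ × Bool) ∈ T := fun e =>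
      Finset.mem_product.2 ⟨hk, Finset.mem_product.2
        ⟨Finset.mem_Icc.2 (abs_le.1 hiN), Finset.mem_univ _⟩⟩
    have hR : rad i = √η ∨ (0 < |(i : ℝ)| ∧ rad i = 4 * δ ^ 2 / g / |(i : ℝ)|) := by
      by_cases h0 : i = 0
      · exact Or.inl (by simp [rad, h0])
      · exact Or.inr ⟨abs_pos.2 (by exact_mod_cast h0), by simp [rad, h0]⟩
    rcases small_or_small hα0 hβ0 hg0 hη0.le hη hx hi_half hR with h | h
    · refine ⟨_, hT true, ?_⟩
      have : x - ctr (m / α) i true = p / (α * g) := by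
        simp only [ctr, hmeq, cond_true, hp]
        field_simp
        ring
      simp only [this]
      rw [abs_div, abs_of_pos (by positivity : (0 : ℝ) < α * g), div_lt_iff₀ (by positivity)]
      linarith
    · refine ⟨_, hT false, ?_⟩
      have : x - ctr (m / α) i false = q / (β * g) := by
        simp only [ctr, hmeq, cond_false, hq, hiv']
        field_simp
        ring
      simp only [this]
      rw [abs_div, abs_of_pos (by positivity : (0 : ℝ) < β * g), div_lt_iff₀ (by positivity)]
      linarith
  · have hQ : (Q.card : ℝ) ≤ 4 * g := by
      refine (card_Icc_floor_le (K := g + 1) ?_ (by linarith)).trans (by linarith)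
      rw [div_add' _ _ _ hα0.ne', div_le_div_iff_of_pos_right hα0]
      nlinarith
    have hsum : ∑ t ∈ T, rad t.2.1 ^ s
        = Q.card * (2 * ∑ i ∈ Finset.Icc (-β : ℤ) β, rad i ^ s) := by
      simp only [T, Finset.sum_product, Finset.sum_const, nsmul_eq_mul, Finset.card_univ,
        Fintype.card_bool, Nat.cast_ofNat, Finset.mul_sum]
    rw [hsum]
    have h0 : 0 ≤ ∑ i ∈ Finset.Icc (-β : ℤ) β, rad i ^ s :=
      Finset.sum_nonneg fun i _ => Real.rpow_nonneg (hrad i).1.le _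
    have h1 : ∑ i ∈ Finset.Icc (-β : ℤ) β, rad i ^ s ≤ _ :=
      sum_Icc_rpow_le hs0 hs1 (by positivity) β
    gcongr

theorem stmt6 (s : ℝ) (hs0 : 0 < s) (hs1 : s < 1) :
    ∃ C : ℝ, 0 < C ∧ ∀ (a b : ℕ) (c d δ ρ : ℝ), 1 ≤ a → a ≤ b →
      0 < δ → δ ≤ 1 / 2 → 1 < ρ →
      preH s ρ {x ∈ Icc (0:ℝ) 1 | nint (a * x + c) * nint (b * x + d) < δ ^ 2}
        ≤ ENNReal.ofReal (C * ((b : ℝ) * (δ ^ 2 / b) ^ s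
            + (Nat.gcd a b : ℝ) * (δ ^ 2 / (a * b)) ^ (s / 2))) := by
  have h1s : 0 < 1 - s := by linarith
  refine ⟨8 + 16 * 4 ^ s / (1 - s), by positivity, ?_⟩
  intro a b c d δ ρ ha hab hδ hδ2 hρ
  obtain ⟨α, β, hαβ, hA, hB⟩ := Nat.exists_coprime a b
  set g := Nat.gcd a b with hgdef
  have hg : 0 < g := Nat.gcd_pos_of_pos_left _ ha
  have hα : 0 < α := Nat.pos_of_ne_zero (by rintro rfl; omega)
  have hle : α ≤ β := by
    rw [hA, hB] at hab
    exact Nat.le_of_mul_le_mul_right hab hg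
  have hβ : 0 < β := hα.trans_le hle
  have hα0 : (0 : ℝ) < α := by exact_mod_cast hα
  have hβ0 : (0 : ℝ) < β := by exact_mod_cast hβ
  have hg0 : (0 : ℝ) < g := by exact_mod_cast hg
  have hAr : (a : ℝ) = α * g := by exact_mod_cast hA
  have hBr : (b : ℝ) = β * g := by exact_mod_cast hB
  have key := preH_nint_mul_nint_le hs0 hs1 hαβ hα hle hg (c := c) (d := d) hδ hδ2 hρ
  rw [hAr, hBr]
  refine key.trans (ENNReal.ofReal_le_ofReal ?_)
  have hsqrt : √(δ ^ 2 / (α * g * (β * g))) ^ s = (δ ^ 2 / (α * g * (β * g))) ^ (s / 2) := by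
    rw [Real.sqrt_eq_rpow, ← Real.rpow_mul (by positivity)]
    congr 1
    ring
  have hmain : (g : ℝ) * ((4 * δ ^ 2 / g) ^ s * (β : ℝ) ^ (1 - s))
      = 4 ^ s * (β * g * (δ ^ 2 / (β * g)) ^ s) := by
    rw [Real.div_rpow (by positivity) hg0.le, Real.mul_rpow (by norm_num) (by positivity),
      Real.div_rpow (by positivity) (by positivity), Real.mul_rpow hβ0.le hg0.le,
      Real.rpow_sub hβ0, Real.rpow_one]
    field_simp
  set X := (β * g : ℝ) * (δ ^ 2 / (β * g)) ^ s with hX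
  set Y := (δ ^ 2 / (α * g * (β * g) : ℝ)) ^ (s / 2) with hY
  have hX0 : 0 ≤ X := by positivity
  have hY0 : 0 ≤ g * Y := by positivity
  have heq : 4 * (g : ℝ) * (2 * (√(δ ^ 2 / (α * g * (β * g))) ^ s
      + 2 * ((4 * δ ^ 2 / g) ^ s * ((β : ℝ) ^ (1 - s) / (1 - s)))))
      = 8 * (g * Y) + 16 * 4 ^ s / (1 - s) * X := by
    rw [hsqrt]
    calc _ = 8 * (g * Y) + 16 / (1 - s) * (g * ((4 * δ ^ 2 / g) ^ s * (β : ℝ) ^ (1 - s))) := by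
          ring
      _ = _ := by
          rw [hmain]
          ring
  rw [heq]
  have h4 : 0 ≤ 16 * 4 ^ s / (1 - s) := by positivity
  nlinarith [mul_nonneg h4 hY0]
end

section
/- Let $\{a_n\},\{b_n\},\{c_n\},\{d_n\}$ be real sequences with $1\le a_n\le b_n$ for all $n$, let $\psi:\mathbb{N}\to[0,\infty)$, and let $s\in(0,1)$. If $\sum_{n\in\mathbb{N}}\big[b_n(\psi(n)/b_n)^s+b_n(\psi(n)/b_n)^s\frac{\log b_n}{a_n}+a_n(\psi(n)/(a_nb_n))^{s/2}+(\psi(n)/(a_nb_n))^{s/2}\log b_n\big]<\infty$, then $\mathcal{H}^s(M(\psi))=0$, where $M(\psi)=\{x\in[0,1]:\|a_nx+c_n\|\cdot\|b_nx+d_n\|<\psi(n)\text{ for infinitely many }n\}$. -/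
open Set MeasureTheory
open scoped ENNReal

/-- `log` with the convention that `log x = 1` for `x ≤ e`. -/
noncomputable def clog (x : ℝ) : ℝ := max 1 (Real.log x)

/-- An integral comparison: `∑_{1 ≤ k ≤ K} k⁻ˢ ≤ K¹⁻ˢ / (1 - s)` for `0 < s < 1`. -/
lemma sum_range_inv_rpow_le {s : ℝ} (hs0 : 0 < s) (hs1 : s < 1) (K : ℕ) :
    ∑ k ∈ Finset.range K, (1 / ((k : ℝ) + 1)) ^ s ≤ (K : ℝ) ^ (1 - s) / (1 - s) := by
  have h1s : 0 < 1 - s := by linarith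
  induction K with
  | zero => simp [Real.zero_rpow h1s.ne']
  | succ k ih =>
    rw [Finset.sum_range_succ]
    have hy : (0 : ℝ) < (k : ℝ) + 1 := by positivity
    have hB := rpow_one_add_le_one_add_mul_self (s := -(1 / ((k : ℝ) + 1))) (p := 1 - s)
      (by rw [neg_le_neg_iff, div_le_one hy]; linarith [k.cast_nonneg (α := ℝ)])
      h1s.le (by linarith)
    have e1 : (1 + -(1 / ((k : ℝ) + 1))) = k / (k + 1) := by field_simp; ring
    rw [e1, Real.div_rpow (by positivity) hy.le, div_le_iff₀ (by positivity)] at hB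
    have e2 : ((k : ℝ) + 1) ^ (1 - s) = ((k : ℝ) + 1) * (1 / ((k : ℝ) + 1)) ^ s := by
      rw [Real.rpow_sub hy, Real.rpow_one, Real.div_rpow zero_le_one hy.le, Real.one_rpow]
      ring
    have e3 : (1 + (1 - s) * -(1 / ((k : ℝ) + 1))) * ((k : ℝ) + 1) ^ (1 - s)
        = ((k : ℝ) + 1) ^ (1 - s) - (1 - s) * (1 / ((k : ℝ) + 1)) ^ s := by
      rw [e2]; field_simp; ring
    rw [e3] at hB
    push_cast
    rw [le_div_iff₀ h1s] at ih ⊢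
    linarith

/-- If `u` and `v` are at least `k / (2b)` apart, the sublevel set `|x - u| |x - v| < η` lies in
two intervals of radius `4ηb / k`. -/
lemma abs_sub_le_or_abs_sub_le {x u v η b k : ℝ} (hb : 0 < b) (hk : 0 < k)
    (h : |x - u| * |x - v| < η) (huv : k / (2 * b) ≤ |u - v|) :
    |x - u| ≤ 4 * η * b / k ∨ |x - v| ≤ 4 * η * b / k := by
  by_contra! hcon
  obtain ⟨h1, h2⟩ := hcon
  have hη : 0 < η := lt_of_le_of_lt (by positivity) h
  have htri : |u - v| ≤ |x - u| + |x - v| := by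
    rw [abs_sub_comm x u]
    exact abs_sub_le u x v
  have e : 4 * η * b / k * (k / (4 * b)) = η := by field_simp
  have e' : k / (2 * b) = k / (4 * b) + k / (4 * b) := by field_simp; norm_num
  have hpos : 0 < 4 * η * b / k := by positivity
  have hpos' : 0 < k / (4 * b) := by positivity
  rcases le_total (k / (4 * b)) (|x - u|) with h3 | h3
  · nlinarith
  · have h4 : k / (4 * b) ≤ |x - v| := by linarith
    nlinarith

/-- The radius of the intervals used to cover the part of the sublevel set near centres which are
about `k / b` apart. -/
noncomputable def coverRadius (η b : ℝ) (k : ℕ) : ℝ :=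
  if k = 0 then √η else 4 * η * b / k

lemma coverRadius_nonneg {η b : ℝ} (hη : 0 ≤ η) (hb : 0 ≤ b) (k : ℕ) :
    0 ≤ coverRadius η b k := by
  unfold coverRadius; split_ifs <;> positivity

/-- The three intervals attached to the indices `j` and `k`. -/
def coverPiece (a b c d η : ℝ) (jk : ℕ × ℕ) : Set ℝ :=
  Metric.closedBall ((round c + jk.1 - c) / a) (coverRadius η b jk.2) ∪
  (Metric.closedBall ((round (b * ((round c + jk.1 - c) / a) + d) + jk.2 - d) / b)
    (coverRadius η b jk.2) ∪
  Metric.closedBall ((round (b * ((round c + jk.1 - c) / a) + d) - jk.2 - d) / b)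
    (coverRadius η b jk.2))

lemma exists_mem_coverPiece {a b c d p x : ℝ} (ha : 1 ≤ a) (hab : a ≤ b)
    (hx : x ∈ Icc (0 : ℝ) 1) (h : nint (a * x + c) * nint (b * x + d) < p) :
    ∃ j k : ℕ, (j : ℝ) ≤ a + 1 ∧ (k : ℝ) ≤ 2 * (b / a) ∧
      x ∈ coverPiece a b c d (p / (a * b)) (j, k) := by
  have ha0 : 0 < a := by linarith
  have hb0 : 0 < b := by linarith
  unfold nint at h
  have hP := abs_sub_round (a * x + c)
  have hQ := abs_sub_round (b * x + d)
  have hC := abs_sub_round c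
  have hmono : round c ≤ round (a * x + c) := by
    rw [round_eq, round_eq]
    apply Int.floor_le_floor
    nlinarith [hx.1]
  obtain ⟨j, hj⟩ := Int.eq_ofNat_of_zero_le (sub_nonneg.2 hmono)
  have hjP : (round (a * x + c) : ℝ) = round c + j := by
    have : round (a * x + c) = round c + (j : ℤ) := by omega
    rw [this]; push_cast; rfl
  set u : ℝ := (round c + j - c) / a with hu
  have hau : a * u = round c + j - c := by rw [hu]; field_simp
  set q := round (b * x + d) with hq
  set m := round (b * u + d) with hm
  have hM := abs_sub_round (b * u + d)
  rw [← hm] at hM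
  set v : ℝ := (q - d) / b with hv
  have hbv : b * v = q - d := by rw [hv]; field_simp
  have exu : a * x + c - round (a * x + c) = a * (x - u) := by
    rw [hjP, mul_sub, hau]; ring
  have exv : b * x + d - q = b * (x - v) := by rw [mul_sub, hbv]; ring
  rw [exu, abs_mul, abs_of_pos ha0] at hP
  rw [exv, abs_mul, abs_of_pos hb0] at hQ
  rw [exu, exv, abs_mul, abs_mul, abs_of_pos ha0, abs_of_pos hb0] at h
  have hprod : |x - u| * |x - v| < p / (a * b) := by
    rw [lt_div_iff₀ (by positivity)]; linarith
  set k := (q - m).natAbs with hk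
  have hkabs : (k : ℝ) = |(q : ℝ) - m| := by
    rw [hk, Nat.cast_natAbs]; push_cast; rfl
  have hqm : (q : ℝ) - m = b * (v - u) + (b * u + d - m) := by linarith
  have hk_le : (k : ℝ) ≤ b * |v - u| + 1 / 2 := by
    rw [hkabs, hqm]
    refine (abs_add_le _ _).trans ?_
    rw [abs_mul, abs_of_pos hb0]
    linarith
  have htri : |v - u| ≤ |x - v| + |x - u| := by
    rw [abs_sub_comm x v]
    exact abs_sub_le v x u
  have hba : 1 ≤ b / a := (one_le_div ha0).2 hab
  refine ⟨j, k, ?_, ?_, ?_⟩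
  · have := abs_le.1 hC
    have h2 := abs_le.1 (abs_sub_round (a * x + c))
    rw [hjP] at h2
    nlinarith [hx.2, this.1, this.2, h2.1, h2.2]
  · have h1 : b * |x - u| ≤ b / a * (1 / 2) := by
      have : b * |x - u| = b / a * (a * |x - u|) := by field_simp
      rw [this]
      gcongr
    nlinarith
  · have hcases : |x - u| ≤ coverRadius (p / (a * b)) b k ∨
        |x - v| ≤ coverRadius (p / (a * b)) b k := by
      by_cases hk0 : k = 0
      · simp only [coverRadius, hk0, if_true]
        by_contra! hcon
        have hη : 0 ≤ p / (a * b) := (by positivity : 0 ≤ |x - u| * |x - v|).trans hprod.le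
        have := mul_lt_mul'' hcon.1 hcon.2 (Real.sqrt_nonneg _) (Real.sqrt_nonneg _)
        rw [Real.mul_self_sqrt hη] at this
        linarith
      · simp only [coverRadius, hk0, if_false]
        have hk1 : (1 : ℝ) ≤ k := by exact_mod_cast Nat.one_le_iff_ne_zero.2 hk0
        apply abs_sub_le_or_abs_sub_le hb0 (by linarith) hprod
        rw [div_le_iff₀ (by positivity), abs_sub_comm]
        nlinarith
    rcases hcases with h1 | h1
    · left
      rw [Metric.mem_closedBall, Real.dist_eq]
      exact h1
    · right
      have hsign : (q : ℝ) = m + k ∨ (q : ℝ) = m - k := by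
        rcases Int.natAbs_eq (q - m) with h2 | h2
        · left; have : q = m + (k : ℤ) := by omega
          rw [this]; push_cast; rfl
        · right; have : q = m - (k : ℤ) := by omega
          rw [this]; push_cast; rfl
      rcases hsign with h2 | h2
      · left
        rw [Metric.mem_closedBall, Real.dist_eq]
        simpa only [hv, h2] using h1
      · right
        rw [Metric.mem_closedBall, Real.dist_eq]
        simpa only [hv, h2] using h1

lemma sum_coverRadius_rpow_le {η b s : ℝ} (hη : 0 ≤ η) (hb : 0 ≤ b) (hs0 : 0 < s) (hs1 : s < 1)
    (K : ℕ) :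
    ∑ k ∈ Finset.range (K + 1), (2 * coverRadius η b k) ^ s
      ≤ 2 * η ^ (s / 2) + 8 * (η * b) ^ s * ((K : ℝ) ^ (1 - s) / (1 - s)) := by
  have hle : ∀ y : ℝ, 1 ≤ y → y ^ s ≤ y := fun y hy => by
    simpa using Real.rpow_le_rpow_of_exponent_le hy hs1.le
  rw [Finset.sum_range_succ', add_comm]
  apply add_le_add
  · simp only [coverRadius, if_true]
    rw [Real.mul_rpow (by norm_num) (Real.sqrt_nonneg _), Real.sqrt_eq_rpow,
      ← Real.rpow_mul hη, show 1 / 2 * s = s / 2 by ring]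
    gcongr
    exact hle 2 (by norm_num)
  · have : ∀ k ∈ Finset.range K, (2 * coverRadius η b (k + 1)) ^ s
        ≤ 8 * (η * b) ^ s * (1 / ((k : ℝ) + 1)) ^ s := fun k _ => by
      have e : 2 * coverRadius η b (k + 1) = 8 * (η * b) * (1 / ((k : ℝ) + 1)) := by
        simp [coverRadius]; ring
      rw [e, Real.mul_rpow (by positivity) (by positivity),
        Real.mul_rpow (by norm_num) (by positivity)]
      gcongr
      exact hle 8 (by norm_num)
    refine (Finset.sum_le_sum this).trans ?_
    rw [← Finset.mul_sum]
    gcongr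
    exact sum_range_inv_rpow_le hs0 hs1 K

lemma outerMeasure_multiplicative_le {a b c d p s ρ : ℝ} (ha : 1 ≤ a) (hab : a ≤ b) (hp : 0 ≤ p)
    (hs0 : 0 < s) (hs1 : s < 1) (ν : OuterMeasure ℝ)
    (hν : ∀ u r : ℝ, 0 ≤ r → r ≤ ρ → ν (Metric.closedBall u r) ≤ ENNReal.ofReal ((2 * r) ^ s))
    (h1 : √(p / (a * b)) ≤ ρ) (h2 : 4 * (p / a) ≤ ρ) :
    ν {x ∈ Icc (0 : ℝ) 1 | nint (a * x + c) * nint (b * x + d) < p} ≤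
      ENNReal.ofReal (144 / (1 - s) *
        (b * (p / b) ^ s + a * (p / (a * b)) ^ (s / 2))) := by
  have ha0 : 0 < a := by linarith
  have hb0 : 0 < b := by linarith
  have h1s : 0 < 1 - s := by linarith
  set η := p / (a * b) with hηdef
  have hη : 0 ≤ η := by positivity
  have hηb : η * b = p / a := by rw [hηdef]; field_simp
  set J := ⌊a + 1⌋₊
  set K := ⌊2 * (b / a)⌋₊
  have hrad : ∀ k, coverRadius η b k ≤ ρ := fun k => by
    unfold coverRadius
    split_ifs with hk
    · exact h1
    · have hk1 : (1 : ℝ) ≤ k := by exact_mod_cast Nat.one_le_iff_ne_zero.2 hk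
      rw [mul_assoc, hηb]
      exact (div_le_self (by positivity) hk1).trans h2
  have hsub : {x ∈ Icc (0 : ℝ) 1 | nint (a * x + c) * nint (b * x + d) < p} ⊆
      ⋃ jk ∈ Finset.range (J + 1) ×ˢ Finset.range (K + 1), coverPiece a b c d η jk := by
    rintro x ⟨hx, hlt⟩
    obtain ⟨j, k, hj, hk, hmem⟩ := exists_mem_coverPiece ha hab hx hlt
    refine mem_biUnion (x := (j, k)) ?_ hmem
    simp only [Finset.mem_coe, Finset.mem_product, Finset.mem_range, Nat.lt_succ_iff]
    exact ⟨Nat.le_floor hj, Nat.le_floor hk⟩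
  have hpiece : ∀ jk, ν (coverPiece a b c d η jk) ≤
      ENNReal.ofReal (3 * (2 * coverRadius η b jk.2) ^ s) := fun jk => by
    have hr := coverRadius_nonneg hη hb0.le jk.2
    have hpos : 0 ≤ (2 * coverRadius η b jk.2) ^ s := by positivity
    rw [show 3 * (2 * coverRadius η b jk.2) ^ s = (2 * coverRadius η b jk.2) ^ s +
      ((2 * coverRadius η b jk.2) ^ s + (2 * coverRadius η b jk.2) ^ s) by ring,
      ENNReal.ofReal_add hpos (by positivity), ENNReal.ofReal_add hpos hpos]
    refine (measure_union_le _ _).trans (add_le_add (hν _ _ hr (hrad _)) ?_)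
    exact (measure_union_le _ _).trans (add_le_add (hν _ _ hr (hrad _)) (hν _ _ hr (hrad _)))
  refine (measure_mono hsub).trans <| (measure_biUnion_finset_le _ _).trans <|
    (Finset.sum_le_sum fun jk _ => hpiece jk).trans ?_
  rw [← ENNReal.ofReal_sum_of_nonneg fun jk _ => by
    have := coverRadius_nonneg hη hb0.le jk.2
    positivity]
  apply ENNReal.ofReal_le_ofReal
  rw [Finset.sum_product]
  dsimp only
  rw [Finset.sum_const, Finset.card_range, nsmul_eq_mul, ← Finset.mul_sum]
  have hJ : ((J + 1 : ℕ) : ℝ) ≤ 3 * a := by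
    have := Nat.floor_le (show 0 ≤ a + 1 by positivity)
    push_cast
    linarith
  have hK : (K : ℝ) ^ (1 - s) ≤ 2 * (b / a) ^ (1 - s) := by
    calc (K : ℝ) ^ (1 - s) ≤ (2 * (b / a)) ^ (1 - s) := by
          gcongr
          exact Nat.floor_le (by positivity)
      _ = 2 ^ (1 - s) * (b / a) ^ (1 - s) := Real.mul_rpow (by norm_num) (by positivity)
      _ ≤ 2 * (b / a) ^ (1 - s) := by
          gcongr
          simpa using Real.rpow_le_rpow_of_exponent_le (x := 2) (by norm_num)
            (show 1 - s ≤ 1 by linarith)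
  have hS := sum_coverRadius_rpow_le hη hb0.le hs0 hs1 K
  have key : a * ((η * b) ^ s * (b / a) ^ (1 - s)) = b * (p / b) ^ s := by
    have hba : 0 < b / a := by positivity
    rw [hηb, Real.rpow_sub hba, Real.rpow_one,
      show p / a = p / b * (b / a) by field_simp, Real.mul_rpow (by positivity) hba.le]
    have : 0 < (b / a) ^ s := by positivity
    field_simp
  have h1inv : 1 ≤ 1 / (1 - s) := by rw [le_div_iff₀ h1s]; linarith
  have hnn : 0 ≤ a * η ^ (s / 2) := by positivity
  have hnn' : 0 ≤ ∑ k ∈ Finset.range (K + 1), (2 * coverRadius η b k) ^ s :=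
    Finset.sum_nonneg fun k _ => by
      have := coverRadius_nonneg hη hb0.le k
      positivity
  calc ((J + 1 : ℕ) : ℝ) * (3 * ∑ k ∈ Finset.range (K + 1), (2 * coverRadius η b k) ^ s)
      ≤ 3 * a * (3 * (2 * η ^ (s / 2) +
          8 * (η * b) ^ s * (2 * (b / a) ^ (1 - s) / (1 - s)))) := by
        gcongr
        refine hS.trans ?_
        gcongr
    _ = 18 * (a * η ^ (s / 2)) +
          144 * (1 / (1 - s)) * (a * ((η * b) ^ s * (b / a) ^ (1 - s))) := by ring
    _ ≤ 144 / (1 - s) * (b * (p / b) ^ s + a * η ^ (s / 2)) := by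
        rw [key]
        have : 144 / (1 - s) = 144 * (1 / (1 - s)) := by ring
        rw [this]
        nlinarith

/-- The Borel–Cantelli lemma for Hausdorff measures, in terms of the outer measures whose
supremum is the Hausdorff measure. -/
lemma hausdorffMeasure_setOf_infinite_eq_zero {s : ℝ} {t : Set ℝ} {P : ℕ → ℝ → Prop} {g : ℕ → ℝ}
    (hs : 0 ≤ s) (hg : Summable g)
    (h : ∀ ρ : ℝ, 0 < ρ → ∃ N, ∀ n ≥ N, ∀ ν : OuterMeasure ℝ,
      (∀ u r : ℝ, 0 ≤ r → r ≤ ρ → ν (Metric.closedBall u r) ≤ ENNReal.ofReal ((2 * r) ^ s)) →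
      ν {x ∈ t | P n x} ≤ ENNReal.ofReal (g n)) :
    μH[s] {x ∈ t | {n | P n x}.Infinite} = 0 := by
  rw [Measure.hausdorffMeasure, ← OuterMeasure.coe_mkMetric]
  unfold OuterMeasure.mkMetric
  rw [OuterMeasure.mkMetric'.eq_iSup_nat, OuterMeasure.iSup_apply, ENNReal.iSup_eq_zero]
  intro i
  set ν := OuterMeasure.mkMetric'.pre (X := ℝ) (fun A => Metric.ediam A ^ s) (i : ℝ≥0∞)⁻¹
  have hρ : (0 : ℝ) < 1 / (2 * (i + 1)) := by positivity
  obtain ⟨N, hN⟩ := h _ hρ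
  have hball : ∀ u r : ℝ, 0 ≤ r → r ≤ 1 / (2 * (i + 1)) →
      ν (Metric.closedBall u r) ≤ ENNReal.ofReal ((2 * r) ^ s) := by
    intro u r hr hrρ
    have hd : Metric.ediam (Metric.closedBall u r) = ENNReal.ofReal (2 * r) := by
      rw [Real.closedBall_eq_Icc, Real.ediam_Icc]
      congr 1; ring
    rw [← ENNReal.ofReal_rpow_of_nonneg (by positivity) hs, ← hd]
    apply OuterMeasure.mkMetric'.pre_le
    rw [hd, ENNReal.le_inv_iff_mul_le, ← ENNReal.ofReal_natCast,
      ← ENNReal.ofReal_mul (by positivity), ← ENNReal.ofReal_one]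
    apply ENNReal.ofReal_le_ofReal
    rw [le_div_iff₀ (by positivity)] at hrρ
    linarith
  have hfin : ∑' n, ν {x | x ∈ t ∧ P (n + N) x} ≠ ∞ := by
    refine ne_top_of_le_ne_top ?_ (ENNReal.tsum_le_tsum fun n => hN (n + N) (by omega) ν hball)
    exact ((summable_nat_add_iff N).2 hg).tsum_ofReal_ne_top
  refine measure_mono_null ?_ (measure_setOfPred_frequently_eq_zero hfin)
  rintro x ⟨hxt, hx⟩
  rw [mem_ofPred_eq, Filter.frequently_atTop]
  intro n
  obtain ⟨k, hk, hkn⟩ := hx.exists_gt (n + N)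
  refine ⟨k - N, by omega, hxt, ?_⟩
  rw [Nat.sub_add_cancel (by omega)]
  exact hk

theorem stmt8 (a b c d : ℕ → ℝ) (ψ : ℕ → ℝ)
    (ha : ∀ n, 1 ≤ a n) (hab : ∀ n, a n ≤ b n) (hψ : ∀ n, 0 ≤ ψ n)
    (s : ℝ) (hs0 : 0 < s) (hs1 : s < 1)
    (hsum : Summable (fun n =>
      b n * (ψ n / b n) ^ s + b n * (ψ n / b n) ^ s * (clog (b n) / a n)
        + a n * (ψ n / (a n * b n)) ^ (s / 2)
        + (ψ n / (a n * b n)) ^ (s / 2) * clog (b n))) :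
    μH[s] {x ∈ Icc (0:ℝ) 1 |
      {n : ℕ | nint (a n * x + c n) * nint (b n * x + d n) < ψ n}.Infinite} = 0 := by
  have ha0 : ∀ n, 0 < a n := fun n => one_pos.trans_le (ha n)
  have hb0 : ∀ n, 0 < b n := fun n => (ha0 n).trans_le (hab n)
  have hA : ∀ n, 0 ≤ b n * (ψ n / b n) ^ s := fun n => by
    have := hb0 n; have := hψ n; positivity
  have hB : ∀ n, 0 ≤ (ψ n / (a n * b n)) ^ (s / 2) := fun n => by
    have := ha0 n; have := hb0 n; have := hψ n; positivity
  have hf : Summable fun n => b n * (ψ n / b n) ^ s + a n * (ψ n / (a n * b n)) ^ (s / 2) := by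
    refine Summable.of_nonneg_of_le
      (fun n => add_nonneg (hA n) (mul_nonneg (ha0 n).le (hB n))) (fun n => ?_) hsum
    have hl : 0 ≤ clog (b n) := zero_le_one.trans (le_max_left _ _)
    have h1 := mul_nonneg (hA n) (div_nonneg hl (ha0 n).le)
    have h2 := mul_nonneg (hB n) hl
    linarith
  refine hausdorffMeasure_setOf_infinite_eq_zero hs0.le (hf.mul_left (144 / (1 - s)))
    fun ρ hρ => ?_
  have hε : 0 < (ρ / 4) ^ s := by positivity
  obtain ⟨N, hN⟩ := Filter.eventually_atTop.1 (hf.tendsto_atTop_zero.eventually_lt_const hε)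
  refine ⟨N, fun n hn ν hν => ?_⟩
  have hlt := hN n hn
  have ha' := ha0 n
  have hb' := hb0 n
  have hψ' := hψ n
  have hη : 0 ≤ ψ n / (a n * b n) := by positivity
  refine outerMeasure_multiplicative_le (ha n) (hab n) (hψ n) hs0 hs1 ν hν ?_ ?_
  · have h1 : (√(ψ n / (a n * b n))) ^ s < (ρ / 4) ^ s := by
      rw [Real.sqrt_eq_rpow, ← Real.rpow_mul hη, show 1 / 2 * s = s / 2 by ring]
      nlinarith [hA n, hB n, ha n]
    have := (Real.rpow_lt_rpow_iff (Real.sqrt_nonneg _) (by positivity) hs0).1 h1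
    linarith
  · have h1 : (ψ n / a n) ^ s < (ρ / 4) ^ s := by
      have hba : 1 ≤ b n / a n := (one_le_div ha').2 (hab n)
      have h2 : (ψ n / a n) ^ s ≤ b n * (ψ n / b n) ^ s := by
        rw [show ψ n / a n = b n / a n * (ψ n / b n) by field_simp,
          Real.mul_rpow (by positivity) (by positivity)]
        gcongr
        calc (b n / a n) ^ s ≤ b n / a n := by
              simpa using Real.rpow_le_rpow_of_exponent_le hba hs1.le
          _ ≤ b n := div_le_self hb'.le (ha n)
      nlinarith [hB n]
    have := (Real.rpow_lt_rpow_iff (by positivity) (by positivity) hs0).1 h1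
    linarith
end
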